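/- arXiv:2602.13001 — 2 statements merged into one kernel-verified Lean document; each statement's English description precedes it below -/
import Mathlib

section
/- For any prime p with p ≡ 3 (mod 4) and any odd positive integer r, ∑_{k=0}^{p^r−1} (8k+1) · (1/4)_k^3 (1/2)_k / ((1)_k^3 (3/4)_k) ≡ 3p^r + (27/4) p^{3r} H^{(2)}_{(p^r−3)/4} (mod p^{r+3}). -/
noncomputable section

/-- Pochhammer symbol `(x)_n = x(x+1)⋯(x+n-1)`. -/
def poch (x : ℚ) (n : ℕ) : ℚ := ∏ i ∈ Finset.range n, (x + i)

/-- `n`-th harmonic number of order 2: `H_n^{(2)} = ∑_{k=1}^n 1/k^2`. -/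
def H2 (n : ℕ) : ℚ := ∑ k ∈ Finset.Icc 1 n, (1 : ℚ) / (k : ℚ) ^ 2

/-- Least nonnegative residue of a rational `x` (with denominator coprime to `m`)
modulo `m`: the unique integer in `{0, …, m-1}` congruent to `x` mod `m`. -/
def res (m : ℕ) (x : ℚ) : ℕ := ((x.num : ZMod m) * (x.den : ZMod m)⁻¹).val

/-- Dwork's dash operation: `x* = (x + ⟨-x⟩_p)/p`. -/
def dash (p : ℕ) (x : ℚ) : ℚ := (x + (res p (-x) : ℚ)) / p

/-- `r`-fold iterate of Dwork's dash operation, with `x^{*_0} = x`. -/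
def dashIter (p r : ℕ) (x : ℚ) : ℚ := (dash p)^[r] x

/-- For rationals `u, v`, `u ≡ v (mod p^m)` means `u = v` or the `p`-adic
valuation of `u - v` is at least `m`. -/
def ratCongr (p : ℕ) (m : ℤ) (u v : ℚ) : Prop :=
  u = v ∨ m ≤ padicValRat p (u - v)

open Finset

theorem poch_succ (x : ℚ) (n : ℕ) : poch x (n+1) = poch x n * (x + n) := by
  unfold poch; rw [prod_range_succ]

theorem poch_zero (x : ℚ) : poch x 0 = 1 := by simp [poch]

theorem poch_succ' (x : ℚ) (n : ℕ) : poch x (n+1) = x * poch (x+1) n := by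
  unfold poch; rw [prod_range_succ', mul_comm]; simp; left
  apply prod_congr rfl; intros; ring

theorem poch_ne (x : ℚ) (n : ℕ) (h : ∀ i : ℕ, x + i ≠ 0) : poch x n ≠ 0 := by
  unfold poch; exact prod_ne_zero_iff.2 (fun i _ => h i)

def tau (k : ℕ) : ℚ := (8 * (k:ℚ) + 1) * poch (1/4) k * poch (1/2) k / (poch 1 k * poch (3/4) k)

def TT (x : ℚ) (k : ℕ) : ℚ :=
  tau k * (poch (1/4-x) k * poch (1/4+x) k / (poch (1+x) k * poch (1-x) k))

theorem pos_ne (a : ℚ) (ha : 0 < a) (i : ℕ) : a + i ≠ 0 := by positivity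

theorem wz (x : ℚ) (h0 : ∀ i : ℕ, -x + i ≠ 0) (h1 : ∀ i : ℕ, 1 + x + i ≠ 0)
    (h2 : 4*x+1 ≠ 0) (N : ℕ) :
    ∑ k ∈ range (N+1), (TT (x+1) k / (4*x+4) - TT x k / (4*x)) =
     -8*(N+1)*(N+1-1/4)*(N+1-x)/(x*(4*x+1)) * (poch (1/4) (N+1) * poch (1/2) (N+1) /
      (poch 1 (N+1) * poch (3/4) (N+1))) * (poch (1/4-x) N * poch (1/4+x) (N+1) /
        (poch (1+x) (N+1) * poch (1-x) (N+1))) := by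
  have hx : x ≠ 0 := by have := h0 0; simpa using this
  have hx1 : 1 + x ≠ 0 := by have := h1 0; simpa using this
  have hx4 : 4 * x + 4 ≠ 0 := by intro h; apply hx1; linarith
  have hx4' : 1/4 + x ≠ 0 := by intro h; apply h2; linarith
  have h0' : ∀ i : ℕ, 1 - x + i ≠ 0 := by
    intro i; have := h0 (i+1); push_cast at this; intro h; apply this; linarith
  induction N with
  | zero =>
    have a1 := h0' 0
    simp only [Nat.cast_zero, add_zero] at a1
    simp [TT, tau, poch_succ, poch_zero]
    rw [show 4*x+4 = 4*(1+x) by ring]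
    field_simp
    ring
  | succ N ih =>
    rw [sum_range_succ, ih]
    unfold TT tau
    have e1 : poch (1/4-(x+1)) (N+1) = (-3/4-x) * poch (1/4-x) N := by
      rw [poch_succ']; ring_nf
    have e2 : poch (1-(x+1)) (N+1) = -x * poch (1-x) N := by
      rw [poch_succ']; ring_nf
    have e3 : poch (1/4+(x+1)) (N+1) = poch (1/4+x) (N+1) * (1/4+x+(N+1)) / (1/4+x) := by
      rw [eq_div_iff hx4']
      have := poch_succ' (1/4+x) (N+1)
      rw [poch_succ (1/4+x) (N+1), add_assoc (1/4) x 1] at this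
      push_cast at this
      linarith
    have e4 : poch (1+(x+1)) (N+1) = poch (1+x) (N+1) * (1+x+(N+1)) / (1+x) := by
      rw [eq_div_iff hx1]
      have := poch_succ' (1+x) (N+1)
      rw [poch_succ (1+x) (N+1), add_assoc 1 x 1] at this
      push_cast at this
      linarith
    rw [e1, e2, e3, e4]
    simp only [poch_succ _ (N+1)]
    rw [poch_succ (1-x) N, poch_succ (1/4-x) N]
    have n1 : poch (1-x) N ≠ 0 := poch_ne _ _ h0'
    have n2 : poch (1+x) (N+1) ≠ 0 := poch_ne _ _ h1
    have n3 : poch 1 (N+1) ≠ 0 := poch_ne _ _ (pos_ne _ (by norm_num))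
    have n4 : poch (3/4) (N+1) ≠ 0 := poch_ne _ _ (pos_ne _ (by norm_num))
    have b1 := h0' N
    have b2 := h0' (N+1)
    have b3 := h1 (N+1)
    push_cast at b2 b3 ⊢
    have b4 : (1:ℚ) + (N+1) ≠ 0 := by positivity
    have b5 : (3:ℚ)/4 + (N+1) ≠ 0 := by positivity
    generalize poch (1-x) N = A1 at *
    generalize poch (1/4-x) N = A2 at *
    generalize poch (1+x) (N+1) = A3 at *
    generalize poch (1/4+x) (N+1) = A4 at *
    generalize poch 1 (N+1) = A5 at *
    generalize poch (3/4) (N+1) = A6 at *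
    generalize poch (1/4) (N+1) = A7 at *
    generalize poch (1/2) (N+1) = A8 at *
    generalize (N:ℚ) = n at *
    have c : A7*A8*A2*A4/(A1*A3*A5*A6) * (
      (8*(n+1)+1)*((-3/4-x)*(1/4+x+(n+1))*(1+x)/((1/4+x)*(1+x+(n+1))*(-x)))/(4*x+4)
      - (8*(n+1)+1)*(1/4-x+n)/(1-x+n)/(4*x)
      + -8*(n+1)*(n+1-1/4)*(n+1-x)/(x*(4*x+1))/(1-x+n)
      - -8*(n+1+1)*(n+1+1-1/4)*(n+1+1-x)/(x*(4*x+1)) * ((1/4+(n+1))*(1/2+(n+1))/((1+(n+1))*(3/4+(n+1)))) * ((1/4-x+n)*(1/4+x+(n+1))/((1+x+(n+1))*(1-x+n)*(1-x+(n+1))))) = 0 := by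
      apply mul_eq_zero_of_right
      have : 4*x+4 = 4*(1+x) := by ring
      rw [this]
      have : 4*x+1 = 4*(1/4+x) := by ring
      rw [this]
      have hz : 1/4 + x = (1+4*x)/4 := by ring
      have hz' : 1+4*x ≠ 0 := by intro h; apply h2; linarith
      rw [hz]
      have hz2 : 3/4 + (n+1) = (7+4*n)/4 := by ring
      have hz2' : 7+4*n ≠ 0 := by intro h; apply b5; linarith
      rw [hz2]
      have hz3 : 4*n+7 ≠ 0 := by rwa [add_comm] at hz2'
      rw [show 7+4*n = 4*n+7 by ring]
      have q1 : n + 1 + 1 - 1/4 = (4*n+7)/4 := by ring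
      rw [q1]
      generalize 4*n+7 = w at *
      field_simp
      ring
    rw [← sub_eq_zero]
    refine Eq.trans ?_ c
    field_simp
    ring

theorem poch_neg_nat (j N : ℕ) (h : j < N) : poch (-(j:ℚ)) N = 0 := by
  unfold poch; exact prod_eq_zero (mem_range.2 h) (by simp)

theorem xj_ne (j : ℕ) (a : ℤ) : (1/4 + (j:ℚ)) ≠ a := by
  intro h
  have : (1 + 4 * (j:ℤ)) = 4 * a := by
    have : (1 + 4 * (j:ℚ)) = 4 * a := by linarith
    exact_mod_cast this
  omega

theorem sum_TT (N j : ℕ) (h : j < N) : ∑ k ∈ range N, TT (1/4 + j) k = 1 + 4 * j := by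
  obtain ⟨N, rfl⟩ : ∃ M, N = M + 1 := ⟨N-1, by omega⟩
  induction j with
  | zero =>
    rw [sum_eq_single 0]
    · simp [TT, tau, poch_zero]
    · intro k _ hk
      have : poch (1/4-(1/4+((0:ℕ):ℚ))) k = 0 := by
        have := poch_neg_nat 0 k (by omega)
        simpa using this
      unfold TT; rw [this]; simp
    · simp
  | succ j ih =>
    have := wz (1/4+j) (by
        intro i hi; apply xj_ne j i; push_cast; linarith)
      (by intro i; positivity) (by positivity) N
    have hz : poch (1/4-(1/4+(j:ℚ))) N = 0 := by
      have := poch_neg_nat j N (by omega)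
      rw [← this]; congr 1; ring
    rw [hz, sum_sub_distrib, ← sum_div, ← sum_div, ih (by omega)] at this
    have h4 : 4 * (1/4 + (j:ℚ)) = 1 + 4 * j := by ring
    have h5 : 4 * (1/4 + (j:ℚ)) + 4 ≠ 0 := by positivity
    rw [h4, div_self (by positivity)] at this
    simp only [zero_mul, zero_div, mul_zero] at this
    rw [sub_eq_zero, div_eq_one_iff_eq (by positivity)] at this
    push_cast
    rw [← add_assoc, this]; ring

open Polynomial in
theorem interp (n : ℕ) (hn : 0 < n) :
    (∑ k ∈ range n, TT 0 k) = ∑ j ∈ range n, (1 + 4 * (j:ℚ)) *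
      ((∏ i ∈ range (n-1), ((i+1:ℚ)^2 - (1/4+j)^2)/(i+1)^2) *
       ∏ l ∈ (range n).erase j, ((1/4 + (l:ℚ))^2 / ((1/4+(l:ℚ))^2 - (1/4+(j:ℚ))^2))) := by
  let P : ℚ[X] := ∑ k ∈ range n, C (tau k) * ((∏ i ∈ range k, (C ((1/4+(i:ℚ))^2) - X)) *
     ∏ i ∈ Ico k (n-1), (C ((i+1:ℚ)^2) - X))
  have hdeg1 : ∀ a : ℚ, (C a - X).natDegree ≤ 1 := by
    intro a; rw [natDegree_sub]; exact (natDegree_X_sub_C_le a)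
  have hdeg : P.degree < (range n).card := by
    rw [card_range]
    apply lt_of_le_of_lt degree_le_natDegree
    have : P.natDegree ≤ n - 1 := by
      apply natDegree_sum_le_of_forall_le
      intro k hk
      rw [mem_range] at hk
      apply (natDegree_C_mul_le _ _).trans
      apply natDegree_mul_le.trans
      have a1 := (natDegree_prod_le (range k) (fun i : ℕ => (C ((1/4+(i:ℚ))^2) - X))).trans
        (sum_le_card_nsmul _ _ 1 (fun i _ => hdeg1 _))
      have a2 := (natDegree_prod_le (Ico k (n-1)) (fun i : ℕ => (C ((i+1:ℚ)^2) - X))).trans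
        (sum_le_card_nsmul _ _ 1 (fun i _ => hdeg1 _))
      simp only [card_range, Nat.card_Ico, smul_eq_mul, mul_one] at a1 a2
      omega
    exact_mod_cast (by omega : P.natDegree < n)
  have heval : ∀ x : ℚ, (∀ i : ℕ, (i+1:ℚ)^2 - x^2 ≠ 0) → P.eval (x^2) =
      (∑ k ∈ range n, TT x k) * ∏ i ∈ range (n-1), ((i+1:ℚ)^2 - x^2) := by
    intro x hx
    rw [sum_mul, eval_finsetSum]
    apply sum_congr rfl
    intro k hk
    rw [mem_range] at hk
    simp only [eval_mul, eval_C, eval_prod, eval_sub, eval_X]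
    have e1 : poch (1/4-x) k * poch (1/4+x) k = ∏ i ∈ range k, ((1/4+(i:ℚ))^2 - x^2) := by
      unfold poch; rw [← prod_mul_distrib]; apply prod_congr rfl; intros; ring
    have e2 : poch (1+x) k * poch (1-x) k = ∏ i ∈ range k, ((i+1:ℚ)^2 - x^2) := by
      unfold poch; rw [← prod_mul_distrib]; apply prod_congr rfl; intros; ring
    unfold TT
    rw [e1, e2, ← prod_range_mul_prod_Ico _ (show k ≤ n - 1 by omega)]
    have : ∏ i ∈ range k, ((i+1:ℚ)^2 - x^2) ≠ 0 := prod_ne_zero_iff.2 (fun i _ => hx i)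
    field_simp
  have hinj : Set.InjOn (fun j : ℕ => (1/4+(j:ℚ))^2) (range n) := by
    intro a _ b _ hab
    have : (1/4+(a:ℚ)) = 1/4+(b:ℚ) := by
      apply (sq_eq_sq₀ (by positivity) (by positivity)).1 hab
    have : (a:ℚ) = b := by linarith
    exact_mod_cast this
  have hL := Lagrange.eq_interpolate hinj hdeg
  have h0 := heval 0 (by intro i; simp; positivity)
  rw [hL, Lagrange.interpolate_apply, eval_finsetSum] at h0
  have hne : ∏ i ∈ range (n-1), ((i+1:ℚ)^2 - 0^2) ≠ 0 :=
    prod_ne_zero_iff.2 (fun i _ => by simp; positivity)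
  rw [← mul_left_inj' hne, ← h0, sum_mul]
  apply sum_congr rfl
  intro j hj
  rw [mem_range] at hj
  rw [heval (1/4+j), sum_TT n j hj]
  · simp only [eval_mul, eval_C, Lagrange.basis, eval_prod, Lagrange.basisDivisor, eval_sub, eval_X]
    rw [prod_div_distrib]
    have e : ∀ l ∈ (range n).erase j, ((1/4+(j:ℚ))^2 - (1/4+(l:ℚ))^2)⁻¹ * (0^2 - (1/4+(l:ℚ))^2) =
      (1/4 + (l:ℚ))^2 / ((1/4+(l:ℚ))^2 - (1/4+(j:ℚ))^2) := by
      intro l _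
      rw [← neg_sub ((1/4+(l:ℚ))^2), inv_neg]; ring
    rw [prod_congr rfl e]
    simp only [ne_eq, OfNat.ofNat_ne_zero, not_false_eq_true, zero_pow, sub_zero] at hne ⊢
    field_simp
  · intro i h
    have : ((i+1:ℚ)) = (1/4+j) := 
      (sq_eq_sq₀ (by positivity) (by positivity)).1 (by linarith)
    apply xj_ne j (i+1); push_cast; linarith

def DD (p : ℕ) (m : ℤ) (x : ℚ) : Prop := padicNorm p x ≤ (p:ℚ)^(-m)

set_option linter.unusedSectionVars false
section
variable {p : ℕ} [hpf : Fact p.Prime]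

theorem p_one_le : (1:ℚ) ≤ p := by exact_mod_cast hpf.out.one_lt.le
theorem p_one_lt : (1:ℚ) < p := by exact_mod_cast hpf.out.one_lt

theorem DD.mono {m k : ℤ} {x : ℚ} (h : DD p m x) (hk : k ≤ m) : DD p k x :=
  le_trans h (zpow_le_zpow_right₀ p_one_le (by omega))

theorem DD.add {m : ℤ} {x y : ℚ} (h : DD p m x) (h' : DD p m y) : DD p m (x+y) :=
  padicNorm.nonarchimedean.trans (max_le h h')

theorem DD.neg {m : ℤ} {x : ℚ} (h : DD p m x) : DD p m (-x) := by
  unfold DD at *; rwa [padicNorm.neg]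

theorem DD.sub {m : ℤ} {x y : ℚ} (h : DD p m x) (h' : DD p m y) : DD p m (x-y) := by
  rw [sub_eq_add_neg]; exact h.add h'.neg

theorem DD.mul {m k : ℤ} {x y : ℚ} (h : DD p m x) (h' : DD p k y) : DD p (m+k) (x*y) := by
  unfold DD at *
  rw [padicNorm.mul, neg_add, zpow_add₀ (by have := @p_one_lt p _; positivity)]
  exact mul_le_mul h h' (padicNorm.nonneg _) (by positivity)

theorem DD.int (z : ℤ) : DD p 0 (z:ℚ) := by
  unfold DD; simpa using padicNorm.of_int z

theorem DD.one : DD p 0 1 := by simpa using DD.int (p := p) 1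

theorem DD.zero (m : ℤ) : DD p m 0 := by unfold DD; simp; positivity

theorem DD.imul {m : ℤ} {x : ℚ} (z : ℤ) (h : DD p m x) : DD p m (z*x) := by
  have := (DD.int (p := p) z).mul h; rwa [zero_add] at this

theorem DD.sum {ι : Type*} {m : ℤ} (s : Finset ι) (f : ι → ℚ) (h : ∀ i ∈ s, DD p m (f i)) :
    DD p m (∑ i ∈ s, f i) := by
  classical
  induction s using Finset.induction_on with
  | empty => simpa using DD.zero m
  | insert a s ha ih =>
    rw [sum_insert ha]
    exact (h a (mem_insert_self _ _)).add (ih (fun i hi => h i (mem_insert_of_mem hi)))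

theorem DD.prod0 {ι : Type*} (s : Finset ι) (f : ι → ℚ) (h : ∀ i ∈ s, DD p 0 (f i)) :
    DD p 0 (∏ i ∈ s, f i) := by
  classical
  induction s using Finset.induction_on with
  | empty => simpa using DD.one
  | insert a s ha ih =>
    rw [prod_insert ha]
    have := (h a (mem_insert_self _ _)).mul (ih (fun i hi => h i (mem_insert_of_mem hi)))
    simpa using this

theorem DD.prod_sub {ι : Type*} {m : ℤ} (s : Finset ι) (f g : ι → ℚ)
    (hf : ∀ i ∈ s, DD p 0 (f i)) (hg : ∀ i ∈ s, DD p 0 (g i))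
    (h : ∀ i ∈ s, DD p m (f i - g i)) :
    DD p m (∏ i ∈ s, f i - ∏ i ∈ s, g i) := by
  classical
  induction s using Finset.induction_on with
  | empty => simpa using DD.zero m
  | insert a s ha ih =>
    rw [prod_insert ha, prod_insert ha]
    have h1 := (h a (mem_insert_self _ _)).mul (DD.prod0 (p := p) s f (fun i hi => hf i (mem_insert_of_mem hi)))
    have h2 := (hg a (mem_insert_self _ _)).mul (ih (fun i hi => hf i (mem_insert_of_mem hi))
      (fun i hi => hg i (mem_insert_of_mem hi)) (fun i hi => h i (mem_insert_of_mem hi)))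
    rw [add_zero] at h1
    rw [zero_add] at h2
    have := h1.add h2
    convert this using 1
    ring

theorem DD.norm_one {u : ℚ} (h : DD p 1 (u-1)) : padicNorm p u = 1 := by
  have h1 : padicNorm p (u-1) < 1 := by
    apply lt_of_le_of_lt h
    rw [zpow_neg_one]
    exact inv_lt_one_of_one_lt₀ p_one_lt
  have : padicNorm p (u - 1 + 1) = max (padicNorm p (u-1)) (padicNorm p 1) :=
    padicNorm.add_eq_max_of_ne (by rw [padicNorm.one]; exact h1.ne)
  rw [padicNorm.one, max_eq_right h1.le] at this
  simpa using this

theorem DD.div_unit {m : ℤ} {x u : ℚ} (h : DD p m x) (hu : padicNorm p u = 1) : DD p m (x/u) := by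
  unfold DD at *; rwa [padicNorm.div, hu, div_one]

theorem DD.unit0 {u : ℚ} (hu : padicNorm p u = 1) : DD p 0 u := by
  unfold DD; rw [hu]; simp

theorem ne_zero_of_norm_one {u : ℚ} (hu : padicNorm p u = 1) : u ≠ 0 := by
  rintro rfl; simp at hu

theorem U_mul {u v : ℚ} (hu : DD p 1 (u-1)) (hv : DD p 1 (v-1)) : DD p 1 (u*v-1) := by
  have h := DD.add (by simpa using hu.mul (DD.unit0 hv.norm_one)) hv
  convert h using 1; ring

theorem U_div {u v : ℚ} (hu : DD p 1 (u-1)) (hv : DD p 1 (v-1)) : DD p 1 (u/v-1) := by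
  have h := (hu.sub hv).div_unit hv.norm_one
  have := ne_zero_of_norm_one hv.norm_one
  convert h using 1; field_simp; ring

theorem U_prod {ι : Type*} (s : Finset ι) (f : ι → ℚ) (h : ∀ i ∈ s, DD p 1 (f i - 1)) :
    DD p 1 (∏ i ∈ s, f i - 1) := by
  have := DD.prod_sub (p := p) (m := 1) s f (fun _ => 1)
    (fun i hi => DD.unit0 (h i hi).norm_one) (fun _ _ => DD.one) h
  simpa using this

theorem norm_one_of_not_dvd {z : ℤ} (h : ¬ (p:ℤ) ∣ z) : padicNorm p z = 1 := by
  rw [padicNorm.int_eq_one_iff]; exact h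

/-- key local estimate -/
theorem key1 (r : ℕ) (t : ℤ) (ht : ¬ ((p:ℤ)^r ∣ t)) : DD p 1 ((p:ℚ)^r / t) := by
  have h0 : t ≠ 0 := by rintro rfl; simp at ht
  have hp0 : (p:ℚ) ≠ 0 := by have := @p_one_lt p _; positivity
  have h1 : ¬ (padicNorm p t ≤ (p:ℚ)^(-(r:ℤ))) := by
    rw [← padicNorm.dvd_iff_norm_le]; exact_mod_cast ht
  have ht' : (t:ℚ) ≠ 0 := by exact_mod_cast h0
  rw [padicNorm.eq_zpow_of_nonzero ht', not_le, zpow_lt_zpow_iff_right₀ p_one_lt] at h1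
  unfold DD
  rw [padicNorm.eq_zpow_of_nonzero (by positivity), padicValRat.div (by positivity) ht',
    padicValRat.pow, padicValRat.self hpf.out.one_lt]
  exact zpow_le_zpow_right₀ p_one_le (by omega)

theorem DDn (r : ℕ) : DD p r ((p:ℚ)^r) := by
  unfold DD
  have h := (padicNorm.dvd_iff_norm_le (p := p) (n := r) (z := (p:ℤ)^r)).1 (by simp)
  simpa using h

theorem key (r : ℕ) (t f : ℤ) (ht : ¬ ((p:ℤ)^r ∣ t)) (w : ℤ) (hf : f = t + (p:ℤ)^r * w) :
    DD p 3 (((p:ℚ)^r / f)^2 - ((p:ℚ)^r / t)^2) ∧ DD p 1 ((f:ℚ)/t - 1) := by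
  have hf' : ¬ ((p:ℤ)^r ∣ f) := by
    rw [hf]; intro h; apply ht; exact (Int.dvd_add_left (dvd_mul_right _ _)).1 h
  have h0 : (t:ℚ) ≠ 0 := by
    intro h; have : t = 0 := by exact_mod_cast h
    subst this; simp at ht
  have h0' : (f:ℚ) ≠ 0 := by
    intro h; have : f = 0 := by exact_mod_cast h
    subst this; simp at hf'
  have a := key1 r t ht
  have b := key1 r f hf'
  have hfq : (f:ℚ) = t + (p:ℚ)^r * w := by rw [hf]; push_cast; ring
  constructor
  · have := ((a.mul b).mul (a.add b)).imul (-w)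
    norm_num at this
    convert this using 1
    have e : (p:ℚ)^r / f - (p:ℚ)^r / t = -w * ((p:ℚ)^r / t * ((p:ℚ)^r / f)) := by
      field_simp
      rw [hfq]; ring
    rw [sq_sub_sq, e]; ring
  · have := a.imul w
    convert this using 1
    rw [hfq]; field_simp; ring
end
section
variable {p : ℕ} [hpf : Fact p.Prime]

def rho (n : ℕ) (a b : ℤ) (i : ℕ) : ℕ := ((a * i + b) % (n:ℤ)).toNat

theorem rho_spec (n : ℕ) (hn : 0 < n) (a b : ℤ) (i : ℕ) :
    a * i + b = (rho n a b i : ℤ) + (n:ℤ) * ((a * i + b) / n) ∧ rho n a b i < n := by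
  have hn' : (0:ℤ) < n := by exact_mod_cast hn
  have h1 := Int.emod_nonneg (a * i + b) hn'.ne'
  have h2 := Int.emod_lt_of_pos (a * i + b) hn'
  have h3 := Int.emod_add_mul_ediv (a * i + b) n
  unfold rho
  constructor
  · rw [Int.toNat_of_nonneg h1]; linarith
  · omega

theorem rho_inj (n : ℕ) (hn : 0 < n) (a b : ℤ) (hc : IsCoprime a (n:ℤ)) (i j : ℕ) (hi : i < n)
    (hj : j < n) (h : (n:ℤ) ∣ (a * i + b) - (a * j + b)) : i = j := by
  have h1 : (n:ℤ) ∣ a * ((i:ℤ) - j) := by convert h using 1; ring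
  have h2 : (n:ℤ) ∣ (i:ℤ) - j := hc.symm.dvd_of_dvd_mul_left h1
  have h3 := Int.eq_zero_of_abs_lt_dvd h2 (by rw [abs_lt]; omega)
  omega

theorem rho_image (n : ℕ) (hn : 0 < n) (a b : ℤ) (hc : IsCoprime a (n:ℤ)) (i0 : ℕ) (hi0 : i0 < n)
    (hd : (n:ℤ) ∣ a * i0 + b) :
    Set.InjOn (rho n a b) ((range n).erase i0) ∧
      ((range n).erase i0).image (rho n a b) = Ico 1 n := by
  have hinj : Set.InjOn (rho n a b) ((range n).erase i0) := by
    intro i hi j hj hij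
    simp only [coe_erase, coe_range, Set.mem_sdiff, Set.mem_Iio] at hi hj
    apply rho_inj n hn a b hc i j hi.1 hj.1
    have e1 := (rho_spec n hn a b i).1
    have e2 := (rho_spec n hn a b j).1
    rw [e1, e2, hij]
    exact ⟨(a * i + b) / n - (a * j + b) / n, by ring⟩
  refine ⟨hinj, ?_⟩
  apply eq_of_subset_of_card_le
  · intro t ht
    rw [mem_image] at ht
    obtain ⟨i, hi, rfl⟩ := ht
    rw [mem_erase, mem_range] at hi
    have e1 := rho_spec n hn a b i
    rw [mem_Ico]
    refine ⟨?_, e1.2⟩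
    by_contra h0
    have h0 : rho n a b i = 0 := by omega
    apply hi.1
    apply rho_inj n hn a b hc i i0 hi.2 hi0
    apply dvd_sub _ hd
    rw [e1.1, h0]; simp
  · rw [card_image_of_injOn hinj, card_erase_of_mem (by simpa using hi0)]
    simp

theorem not_dvd_lt (n t : ℕ) (h1 : 1 ≤ t) (h2 : t < n) : ¬ ((n:ℤ) ∣ (t:ℤ)) := by
  intro h
  have := Nat.le_of_dvd h1 (by exact_mod_cast h)
  omega

theorem key' (r n : ℕ) (hn : n = p^r) (a b : ℤ) (hc : IsCoprime a (n:ℤ)) (i0 : ℕ) (hi0 : i0 < n)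
    (hd : (n:ℤ) ∣ a * i0 + b) (i : ℕ) (hi : i ∈ (range n).erase i0) :
    DD p 3 (((n:ℚ) / (a * i + b))^2 - ((n:ℚ) / (rho n a b i))^2) ∧
    DD p 1 (((a:ℚ) * i + b)/(rho n a b i) - 1) ∧
    DD p 1 ((n:ℚ) / (a * i + b)) ∧ DD p 1 ((n:ℚ) / (rho n a b i)) ∧ (a * i + b : ℚ) ≠ 0 := by
  have hn0 : 0 < n := by rw [hn]; exact pow_pos hpf.out.pos _
  have hm : rho n a b i ∈ Ico 1 n := by
    rw [← (rho_image n hn0 a b hc i0 hi0 hd).2]; exact mem_image_of_mem _ hi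
  rw [mem_Ico] at hm
  have nd := not_dvd_lt n _ hm.1 hm.2
  have e := (rho_spec n hn0 a b i).1
  have hnz : (n:ℤ) = (p:ℤ)^r := by rw [hn]; push_cast; rfl
  have hnq : (n:ℚ) = (p:ℚ)^r := by rw [hn]; push_cast; rfl
  have nd' : ¬ ((n:ℤ) ∣ a * i + b) := by
    rw [e]; intro h; apply nd; exact (Int.dvd_add_left (dvd_mul_right _ _)).1 h
  rw [hnz] at nd
  have K := key (p := p) r (rho n a b i) (a * i + b) nd _ (by rw [← hnz]; exact e)
  have K1 := key1 (p := p) r (rho n a b i) nd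
  have K2 := key1 (p := p) r (a * i + b) (by rw [← hnz]; exact nd')
  rw [hnq]
  push_cast at K K1 K2
  refine ⟨K.1, K.2, K2, K1, ?_⟩
  intro h
  have : a * i + b = 0 := by exact_mod_cast h
  rw [this] at nd'; simp at nd'

theorem lemE (r n : ℕ) (hn : n = p^r) (a b : ℤ) (hc : IsCoprime a (n:ℤ)) (i0 : ℕ) (hi0 : i0 < n)
    (hd : (n:ℤ) ∣ a * i0 + b) : ∃ u : ℚ, DD p 1 (u - 1) ∧
      ∏ i ∈ (range n).erase i0, ((a:ℚ) * i + b) = u * ∏ t ∈ Ico 1 n, (t:ℚ) := by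
  have hn0 : 0 < n := by rw [hn]; exact pow_pos hpf.out.pos _
  have R := rho_image n hn0 a b hc i0 hi0 hd
  refine ⟨∏ i ∈ (range n).erase i0, (((a:ℚ) * i + b)/(rho n a b i)), ?_, ?_⟩
  · exact U_prod _ _ (fun i hi => (key' r n hn a b hc i0 hi0 hd i hi).2.1)
  · rw [prod_div_distrib, ← R.2, prod_image R.1, div_mul_cancel₀]
    rw [← prod_image (f := fun t : ℕ => (t:ℚ)) R.1, R.2]
    apply prod_ne_zero_iff.2
    intro t ht
    rw [mem_Ico] at ht
    have : 0 < t := by omega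
    positivity

theorem lemS (r n : ℕ) (hn : n = p^r) (a b : ℤ) (hc : IsCoprime a (n:ℤ)) (i0 : ℕ) (hi0 : i0 < n)
    (hd : (n:ℤ) ∣ a * i0 + b) :
    DD p 3 (∑ i ∈ (range n).erase i0, ((n:ℚ) / (a * i + b))^2 - ∑ t ∈ Ico 1 n, ((n:ℚ)/t)^2) := by
  have hn0 : 0 < n := by rw [hn]; exact pow_pos hpf.out.pos _
  have R := rho_image n hn0 a b hc i0 hi0 hd
  rw [← R.2, sum_image R.1, ← sum_sub_distrib]
  exact DD.sum _ _ (fun i hi => (key' r n hn a b hc i0 hi0 hd i hi).1)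

theorem U_sq {x : ℚ} (h : DD p 1 x) : DD p 1 ((1 - 9 * x^2) - 1) := by
  have := ((h.mul h).mono (k := 1) (by norm_num)).imul (-9)
  convert this using 1; push_cast; ring

theorem lemV (r n : ℕ) (hn : n = p^r) (a b : ℤ) (hc : IsCoprime a (n:ℤ)) (i0 : ℕ) (hi0 : i0 < n)
    (hd : (n:ℤ) ∣ a * i0 + b) :
    DD p 3 (∏ i ∈ (range n).erase i0, (1 - 9 * ((n:ℚ) / (a * i + b))^2)
      - ∏ t ∈ Ico 1 n, (1 - 9 * ((n:ℚ)/t)^2)) ∧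
    DD p 1 (∏ i ∈ (range n).erase i0, (1 - 9 * ((n:ℚ) / (a * i + b))^2) - 1) := by
  have hn0 : 0 < n := by rw [hn]; exact pow_pos hpf.out.pos _
  have R := rho_image n hn0 a b hc i0 hi0 hd
  have K := key' r n hn a b hc i0 hi0 hd
  constructor
  · rw [← R.2, prod_image R.1]
    apply DD.prod_sub
    · intro i hi; exact DD.unit0 (U_sq (K i hi).2.2.1).norm_one
    · intro i hi; exact DD.unit0 (U_sq (K i hi).2.2.2.1).norm_one
    · intro i hi
      have := (K i hi).1.imul (-9)
      convert this using 1; push_cast; ring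
  · exact U_prod _ _ (fun i hi => U_sq (K i hi).2.2.1)
end
section
variable {p : ℕ} [hpf : Fact p.Prime]

def WW (n j : ℕ) : ℚ := (∏ i ∈ range (n-1), ((i+1:ℚ)^2 - (1/4+j)^2)/(i+1)^2) *
       ∏ l ∈ (range n).erase j, ((1/4 + (l:ℚ))^2 / ((1/4+(l:ℚ))^2 - (1/4+(j:ℚ))^2))

theorem erase_zero (n : ℕ) (hn : 0 < n) : (range n).erase 0 = Ico 1 n := by
  ext x; simp; omega

theorem prod_shift (n : ℕ) (hn : 0 < n) (f : ℕ → ℚ) :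
    ∏ i ∈ range (n-1), f (i+1) = ∏ i ∈ (range n).erase 0, f i := by
  rw [erase_zero n hn, prod_Ico_eq_prod_range]
  apply prod_congr rfl; intros; rw [add_comm]

theorem WW_eq (n j : ℕ) (hn : 0 < n) : WW n j =
    (∏ i ∈ (range n).erase 0, (4 * (i:ℚ) - (1+4*j))) * (∏ i ∈ (range n).erase 0, (4 * (i:ℚ) + (1+4*j)))
     / (∏ i ∈ (range n).erase 0, (4 * (i:ℚ)))^2 *
    ((∏ l ∈ (range n).erase j, (4 * (l:ℚ) + 1))^2 /
     ((∏ l ∈ (range n).erase j, (4 * (l:ℚ) - 4 * j)) * (∏ l ∈ (range n).erase j, (4 * (l:ℚ) + (4 * j + 2))))) := by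
  unfold WW
  have := prod_shift n hn (fun i => ((i:ℚ)^2 - (1/4+j)^2)/(i:ℚ)^2)
  push_cast at this
  rw [this]
  rw [← prod_mul_distrib, ← prod_mul_distrib, ← prod_pow, ← prod_pow, ← prod_div_distrib,
    ← prod_div_distrib]
  congr 1
  · apply prod_congr rfl
    intro i _
    rw [show ((4 * (i:ℚ) - (1+4*j)) * (4 * (i:ℚ) + (1+4*j))) = 16 * ((i:ℚ)^2 - (1/4+j)^2) by ring,
      show (4 * (i:ℚ))^2 = 16 * (i:ℚ)^2 by ring, mul_div_mul_left _ _ (by norm_num)]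
  · apply prod_congr rfl
    intro l _
    rw [show ((4 * (l:ℚ) - 4 * j) * (4 * (l:ℚ) + (4 * j + 2))) = 16 * ((1/4+(l:ℚ))^2 - (1/4+(j:ℚ))^2) by ring,
      show (4 * (l:ℚ) + 1)^2 = 16 * (1/4 + (l:ℚ))^2 by ring, mul_div_mul_left _ _ (by norm_num)]

theorem lemFull (r n : ℕ) (hn : n = p^r) (a b : ℤ) (hc : IsCoprime a (n:ℤ)) (c0 : ℕ) (hc0 : c0 < n)
    (i0 : ℕ) (hi0 : i0 < n) (e : ℤ) (hd : a * i0 + b = e * n) : ∃ u : ℚ, DD p 1 (u - 1) ∧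
      (∏ i ∈ (range n).erase c0, ((a:ℚ) * i + b)) * (a * c0 + b) = e * n * (u * ∏ t ∈ Ico 1 n, (t:ℚ)) := by
  obtain ⟨u, hu, h⟩ := lemE (p := p) r n hn a b hc i0 hi0 (by rw [hd]; exact dvd_mul_left _ _)
  refine ⟨u, hu, ?_⟩
  have hd' : (a:ℚ) * i0 + b = e * n := by exact_mod_cast hd
  rw [← h, prod_erase_mul _ _ (mem_range.2 hc0), ← hd', mul_prod_erase _ (fun i : ℕ => (a:ℚ) * i + b) (mem_range.2 hi0)]

theorem offm (r n : ℕ) (hn : n = p^r) (h4 : IsCoprime (4:ℤ) (n:ℤ)) (j m i1 i2 i4 : ℕ) (hj : j < n)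
    (hm : m < n) (h1 : i1 < n) (h2 : i2 < n) (h4' : i4 < n) (e1 e2 e4 c : ℤ) (he4 : e4 ≠ 0)
    (hz : ¬ ((n:ℤ) ∣ 1 + 4 * j))
    (hm' : (4:ℤ) * m + 1 = 3 * n) (q1 : (4:ℤ) * i1 - (1 + 4 * j) = e1 * n)
    (q2 : (4:ℤ) * i2 + (1 + 4 * j) = e2 * n) (q4 : (4:ℤ) * i4 + (4 * j + 2) = e4 * n)
    (hcc : 18 * e1 * e2 = - c * e4) :
    DD p (r + 3) ((1 + 4 * j) * WW n j - c * (n * ((n:ℚ) / (4 * j + 1))^2)) := by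
  have hn0 : 0 < n := by rw [hn]; exact pow_pos hpf.out.pos _
  obtain ⟨u1, U1, E1⟩ := lemFull (p := p) r n hn 4 (-(1+4*j)) h4 0 hn0 i1 h1 e1 (by linarith)
  obtain ⟨u2, U2, E2⟩ := lemFull (p := p) r n hn 4 (1+4*j) h4 0 hn0 i2 h2 e2 (by linarith)
  obtain ⟨u3, U3, E3⟩ := lemE (p := p) r n hn 4 (-(4*j)) h4 j hj (by simp)
  obtain ⟨u4, U4, E4⟩ := lemFull (p := p) r n hn 4 (4*j+2) h4 j hj i4 h4' e4 (by linarith)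
  obtain ⟨u5, U5, E5⟩ := lemFull (p := p) r n hn 4 1 h4 j hj m hm 3 (by linarith)
  obtain ⟨u6, U6, E6⟩ := lemE (p := p) r n hn 4 0 h4 0 hn0 (by simp)
  push_cast at E1 E2 E3 E4 E5 E6
  have hF : ∏ t ∈ Ico 1 n, (t:ℚ) ≠ 0 := by
    apply prod_ne_zero_iff.2
    intro t ht
    rw [mem_Ico] at ht
    have : 0 < t := by omega
    positivity
  have hW := WW_eq n j hn0
  simp only [← sub_eq_add_neg, mul_zero, zero_add, zero_sub, add_zero] at E1 E2 E3 E4 E5 E6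
  generalize (∏ i ∈ (range n).erase 0, (4 * (i:ℚ) - (1+4*j))) = P1 at *
  generalize (∏ i ∈ (range n).erase 0, (4 * (i:ℚ) + (1+4*j))) = P2 at *
  generalize (∏ i ∈ (range n).erase 0, (4 * (i:ℚ))) = P6 at *
  generalize (∏ l ∈ (range n).erase j, (4 * (l:ℚ) + 1)) = P5 at *
  generalize (∏ l ∈ (range n).erase j, (4 * (l:ℚ) - 4 * j)) = P3 at *
  generalize (∏ l ∈ (range n).erase j, (4 * (l:ℚ) + (4 * j + 2))) = P4 at *
  generalize ∏ t ∈ Ico 1 n, (t:ℚ) = F at *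
  have hzp : (1 + 4 * (j:ℚ)) ≠ 0 := by positivity
  have hnq : (n:ℚ) ≠ 0 := by positivity
  have v1 := ne_zero_of_norm_one U1.norm_one
  have v2 := ne_zero_of_norm_one U2.norm_one
  have v3 := ne_zero_of_norm_one U3.norm_one
  have v4 := ne_zero_of_norm_one U4.norm_one
  have v5 := ne_zero_of_norm_one U5.norm_one
  have v6 := ne_zero_of_norm_one U6.norm_one
  have he4q : (e4:ℚ) ≠ 0 := by exact_mod_cast he4
  rw [show 4 * (j:ℚ) + (4 * j + 2) = 2 * (1 + 4 * j) by ring] at E4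
  rw [show 4 * (j:ℚ) + 1 = 1 + 4 * j by ring] at E5 ⊢
  set z : ℚ := 1 + 4 * (j:ℚ) with hzdef
  have E1' : P1 = - (e1 * n * (u1 * F) / z) := by
    field_simp; linarith
  have E2' : P2 = e2 * n * (u2 * F) / z := by
    field_simp; linarith
  have E4' : P4 = e4 * n * (u4 * F) / (2 * z) := by
    field_simp; linarith
  have E5' : P5 = 3 * n * (u5 * F) / z := by
    field_simp; linarith
  have hccq : 18 * (e1:ℚ) * e2 = - c * e4 := by exact_mod_cast hcc
  have key3 : z * WW n j = (c * (n * ((n:ℚ) / z)^2)) * (u1 * u2 * (u5 * u5) / (u6 * u6 * u3 * u4)) := by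
    have e : (c:ℚ) = -(18 * e1 * e2) / e4 := by field_simp; linarith
    rw [hW, E1', E2', E3, E4', E5', E6, e]
    field_simp
    ring
  have hU : DD p 1 (u1 * u2 * (u5 * u5) / (u6 * u6 * u3 * u4) - 1) :=
    U_div (U_mul (U_mul U1 U2) (U_mul U5 U5)) (U_mul (U_mul (U_mul U6 U6) U3) U4)
  have hk : DD p 1 ((n:ℚ)/z) := by
    have := key1 (p := p) r (1 + 4 * j) (by intro h; apply hz; rw [hn]; push_cast; exact h)
    rw [hn]; push_cast at this ⊢; exact this
  have hN : DD p r (n:ℚ) := by rw [hn]; push_cast; exact DDn r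
  have hfin := (((hN.mul (hk.mul hk)).imul c).mul hU)
  rw [key3]
  convert hfin using 1 <;> ring

theorem onm (r n : ℕ) (hn : n = p^r) (h4 : IsCoprime (4:ℤ) (n:ℤ)) (m : ℕ)
    (hm : m < n) (hm' : (4:ℤ) * m + 1 = 3 * n) :
    DD p (r + 3) ((1 + 4 * m) * WW n m - 3 * n) := by
  have hn0 : 0 < n := by rw [hn]; exact pow_pos hpf.out.pos _
  have V1 := lemV (p := p) r n hn 4 0 h4 0 hn0 (by simp)
  have V2 := lemV (p := p) r n hn 4 1 h4 m hm (by rw [hm']; exact dvd_mul_left _ _)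
  have K := key' (p := p) r n hn 4 1 h4 m hm (by rw [hm']; exact dvd_mul_left _ _)
  have hmq : (4:ℚ) * m + 1 = 3 * n := by exact_mod_cast hm'
  have hmq' : (1/4:ℚ) + m = 3 * n / 4 := by linarith
  have hW : WW n m = (∏ i ∈ (range n).erase 0, (1 - 9 * ((n:ℚ) / ((4:ℤ) * i + (0:ℤ)))^2)) /
      ∏ i ∈ (range n).erase m, (1 - 9 * ((n:ℚ) / ((4:ℤ) * i + (1:ℤ)))^2) := by
    unfold WW
    have := prod_shift n hn0 (fun i => ((i:ℚ)^2 - (1/4+m)^2)/(i:ℚ)^2)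
    push_cast at this
    rw [this]
    refine Eq.trans ?_ (div_eq_mul_inv _ _).symm
    rw [← prod_inv_distrib]
    congr 1
    · apply prod_congr rfl
      intro i hi
      have : i ≠ 0 := (mem_erase.1 hi).1
      rw [hmq']; push_cast; field_simp; ring
    · apply prod_congr rfl
      intro i hi
      have := (K i hi).2.2.2.2
      push_cast at this
      rw [hmq']; push_cast
      rw [show (1/4 + (i:ℚ)) = (4 * i + 1)/4 by ring]
      rw [← inv_div]
      congr 1
      field_simp; ring
  have hV : DD p 3 (WW n m - 1) := by
    have h := (V1.1.sub V2.1).div_unit V2.2.norm_one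
    have := ne_zero_of_norm_one V2.2.norm_one
    rw [hW]
    convert h using 1
    rw [sub_sub_sub_cancel_right, sub_div, div_self this]
  have hN : DD p r (n:ℚ) := by rw [hn]; push_cast; exact DDn r
  have := (hN.mul hV).imul 3
  convert this using 1
  rw [show (1:ℚ) + 4 * m = 3 * n by linarith]; push_cast; ring

def cc (q j : ℕ) : ℤ := if j ≤ 2*q+1 then -27 else if j < 3*q+2 then -9 else 63

theorem H2_eq (q : ℕ) : H2 q = ∑ x ∈ range q, (1:ℚ)/((x:ℚ)+1)^2 := by
  unfold H2
  induction q with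
  | zero => simp
  | succ k ih => rw [sum_Icc_succ_top (by omega), ih, sum_range_succ]; push_cast; rfl

theorem final (r n q : ℕ) (hn : n = p^r) (hq : n = 4 * q + 3) (hp2 : p ≠ 2) :
    DD p 3 (∑ j ∈ (range n).erase (3*q+2), (cc q j : ℚ) * ((n:ℚ) / (4 * j + 1))^2
      - 27/4 * (n:ℚ)^2 * H2 q) := by
  have hn0 : 0 < n := by omega
  have hqZ : (n:ℤ) = 4 * q + 3 := by exact_mod_cast hq
  have h2 : IsCoprime (2:ℤ) (n:ℤ) := ⟨-(2*q+1), 1, by rw [hqZ]; ring⟩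
  have h4 : IsCoprime (4:ℤ) (n:ℤ) := by
    rw [show (4:ℤ) = 2 * 2 by norm_num]; exact h2.mul_left h2
  have hqQ : (n:ℚ) = 4 * q + 3 := by exact_mod_cast hq
  have S1 := lemS (p := p) r n hn 4 1 h4 (3*q+2) (by omega) (by
    rw [hqZ]; push_cast; exact ⟨3, by ring⟩)
  have S2 := lemS (p := p) r n hn 2 0 h2 0 (by omega) (by simp)
  have S2' : DD p 3 (27 * ∑ t ∈ Ico 1 n, ((n:ℚ)/t)^2) := by
    have := S2.imul (-36)
    convert this using 1
    rw [erase_zero n hn0]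
    have : ∑ i ∈ Ico 1 n, ((n:ℚ) / ((2:ℤ) * i + (0:ℤ)))^2 = 1/4 * ∑ t ∈ Ico 1 n, ((n:ℚ)/t)^2 := by
      rw [mul_sum]; apply sum_congr rfl; intro i hi
      have : 0 < i := by rw [mem_Ico] at hi; omega
      push_cast; field_simp; ring
    rw [this]; push_cast; ring
  have S3 : DD p 3 (27 * ∑ i ∈ (range n).erase (3*q+2), ((n:ℚ) / (4 * i + 1))^2) := by
    have := (S1.imul 27).add S2'
    convert this using 1
    push_cast; ring
  let g : ℕ → ℚ := fun j => ((n:ℚ) / (4 * j + 1))^2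
  let d : ℕ → ℚ := fun j => if j ≤ 2*q+1 then 0 else if j < 3*q+2 then 18 else if j = 3*q+2 then 0 else 90
  have e1 : ∑ j ∈ (range n).erase (3*q+2), (cc q j : ℚ) * ((n:ℚ) / (4 * j + 1))^2 =
      - (27 * ∑ i ∈ (range n).erase (3*q+2), ((n:ℚ) / (4 * i + 1))^2) + ∑ j ∈ range n, d j * g j := by
    rw [← add_sum_erase (range n) (fun j => d j * g j) (mem_range.2 (show 3*q+2 < n by omega))]
    have : d (3*q+2) = 0 := by
      simp only [d]; rw [if_neg (by omega), if_neg (by omega)]; simp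
    rw [this, zero_mul, zero_add, mul_sum, ← sum_neg_distrib, ← sum_add_distrib]
    apply sum_congr rfl
    intro j hj
    have hj' : j ≠ 3*q+2 := (mem_erase.1 hj).1
    simp only [d, g, cc, hj', if_false]
    split_ifs <;> push_cast <;> ring
  have e2 : ∑ j ∈ range n, d j * g j = 18 * ∑ x ∈ range q, g (2*q+2+(q-1-x)) + 90 * ∑ x ∈ range q, g (3*q+3+x) := by
    rw [hq, show 4*q+3 = (2*q+2) + q + 1 + q by ring, sum_range_add, sum_range_add _ (2*q+2+q) 1, sum_range_add]
    have z1 : ∑ x ∈ range (2*q+2), d x * g x = 0 := by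
      apply sum_eq_zero; intro x hx; rw [mem_range] at hx
      simp only [d]; rw [if_pos (by omega), zero_mul]
    have z2 : ∑ x ∈ range 1, d (2*q+2+q+x) * g (2*q+2+q+x) = 0 := by
      rw [sum_range_one]
      simp only [d]; rw [if_neg (by omega), if_neg (by omega), if_pos (by omega), zero_mul]
    rw [z1, z2, zero_add, add_zero, sum_range_reflect (fun x => g (2*q+2+x)), mul_sum, mul_sum]
    congr 1
    · apply sum_congr rfl; intro x hx; rw [mem_range] at hx
      simp only [d]; rw [if_neg (by omega), if_pos (by omega)]
    · apply sum_congr rfl; intro x hx; rw [mem_range] at hx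
      simp only [d]; rw [if_neg (by omega), if_neg (by omega), if_neg (by omega)]
      rw [show 2*q+2+q+1+x = 3*q+3+x by ring]
  have hnz : (n:ℤ) = (p:ℤ)^r := by rw [hn]; push_cast; rfl
  have hnq : (n:ℚ) = (p:ℚ)^r := by rw [hn]; push_cast; rfl
  have nd : ∀ x < q, ¬ ((p:ℤ)^r ∣ 4 * ((x:ℤ)+1)) := by
    intro x hx h
    rw [← hnz] at h
    have := h4.symm.dvd_of_dvd_mul_left h
    exact not_dvd_lt n (x+1) (by omega) (by omega) (by exact_mod_cast this)
  have T1 : DD p 3 (∑ x ∈ range q, (g (2*q+2+(q-1-x)) - ((n:ℚ)/(4*(x+1)))^2)) := by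
    apply DD.sum
    intro x hx
    rw [mem_range] at hx
    have K := (key (p := p) r (4*((x:ℤ)+1)) (-(4 * ((2*q+2+(q-1-x) : ℕ):ℤ) + 1)) (nd x hx) (-3)
      (by rw [← hnz, hqZ]; omega)).1
    rw [← hnq] at K
    convert K using 1
    simp only [g]
    push_cast
    rw [div_neg, neg_sq]
  have T2 : DD p 3 (∑ x ∈ range q, (g (3*q+3+x) - ((n:ℚ)/(4*(x+1)))^2)) := by
    apply DD.sum
    intro x hx
    rw [mem_range] at hx
    have K := (key (p := p) r (4*((x:ℤ)+1)) ((4 * ((3*q+3+x : ℕ):ℤ) + 1)) (nd x hx) 3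
      (by rw [← hnz, hqZ]; push_cast; ring)).1
    rw [← hnq] at K
    convert K using 1
    simp only [g]
    push_cast
    rfl
  have e3 : 27/4 * (n:ℚ)^2 * H2 q = 108 * ∑ x ∈ range q, ((n:ℚ)/(4*(x+1)))^2 := by
    rw [H2_eq, mul_sum, mul_sum]
    apply sum_congr rfl; intro x _
    field_simp; ring
  have := (S3.neg.add (T1.imul 18)).add (T2.imul 90)
  convert this using 1
  rw [e1, e2, e3, sum_sub_distrib, sum_sub_distrib]
  push_cast; ring
end

theorem stmt1 (p : ℕ) (hp : p.Prime) (hp4 : p % 4 = 3)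
    (r : ℕ) (hr : 1 ≤ r) (hrodd : Odd r) :
    ratCongr p ((r : ℤ) + 3)
      (∑ k ∈ Finset.range (p ^ r),
        (8 * (k : ℚ) + 1) * poch (1/4) k ^ 3 * poch (1/2) k /
          (poch 1 k ^ 3 * poch (3/4) k))
      (3 * (p : ℚ) ^ r + 27 / 4 * (p : ℚ) ^ (3 * r) * H2 ((p ^ r - 3) / 4)) := by
  have : Fact p.Prime := ⟨hp⟩
  have hmod : p^r % 4 = 3 := by
    obtain ⟨s, rfl⟩ := hrodd
    rw [pow_succ, pow_mul, Nat.mul_mod, Nat.pow_mod, Nat.pow_mod p 2, hp4]; norm_num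
  obtain ⟨n, hn⟩ : ∃ n, n = p^r := ⟨_, rfl⟩
  obtain ⟨q, hq⟩ : ∃ q, n = 4 * q + 3 := ⟨n/4, by rw [← hn] at hmod; omega⟩
  have hnq : (p:ℚ)^r = n := by rw [hn]; push_cast; rfl
  have hp2 : p ≠ 2 := by rintro rfl; norm_num at hp4
  rw [← hn, show (n-3)/4 = q by omega, mul_comm 3 r, pow_mul, hnq]
  have hT : ∑ k ∈ Finset.range n, (8 * (k : ℚ) + 1) * poch (1/4) k ^ 3 * poch (1/2) k /
          (poch 1 k ^ 3 * poch (3/4) k) = ∑ k ∈ range n, TT 0 k := by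
    apply sum_congr rfl
    intro k _
    unfold TT tau
    rw [sub_zero, add_zero, add_zero, sub_zero, div_mul_div_comm]
    congr 1 <;> ring
  rw [hT, interp n (by omega)]
  have hqZ : (n:ℤ) = 4 * q + 3 := by exact_mod_cast hq
  have h2 : IsCoprime (2:ℤ) (n:ℤ) := ⟨-(2*q+1), 1, by rw [hqZ]; ring⟩
  have h4 : IsCoprime (4:ℤ) (n:ℤ) := by
    rw [show (4:ℤ) = 2 * 2 by norm_num]; exact h2.mul_left h2
  have hm : (4:ℤ) * ((3*q+2:ℕ):ℤ) + 1 = 3 * n := by rw [hqZ]; push_cast; ring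
  have key : DD p (r+3) (∑ j ∈ range n, (1 + 4 * (j:ℚ)) * WW n j -
      (3 * (n:ℚ) + 27/4 * (n:ℚ)^3 * H2 q)) := by
    have hN : DD p r (n:ℚ) := by rw [hn]; push_cast; exact DDn r
    have A := onm (p := p) r n hn h4 (3*q+2) (by omega) hm
    have B := hN.mul (final (p := p) r n q hn hq hp2)
    have C : DD p (r+3) (∑ j ∈ (range n).erase (3*q+2),
        ((1 + 4 * (j:ℚ)) * WW n j - (cc q j : ℚ) * ((n:ℚ) * ((n:ℚ) / (4 * j + 1))^2))) := by
      apply DD.sum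
      intro j hj
      rw [mem_erase, mem_range] at hj
      have hz : ¬ ((n:ℤ) ∣ 1 + 4 * j) := by
        intro h
        apply hj.1
        have h3 : (n:ℤ) ∣ 4 * ((j:ℤ) - (3*q+2:ℕ)) := by
          have := dvd_sub h (dvd_mul_left (n:ℤ) 3)
          have e : 4 * ((j:ℤ) - (3*q+2:ℕ)) = 1 + 4 * j - 3 * n := by rw [← hm]; ring
          rw [e]; exact this
        have h5 := Int.eq_zero_of_abs_lt_dvd (h4.symm.dvd_of_dvd_mul_left h3) (by rw [abs_lt]; omega)
        omega
      by_cases c1 : j ≤ 2*q+1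
      · have : cc q j = -27 := by unfold cc; rw [if_pos c1]
        rw [this]
        exact offm (p := p) r n hn h4 j (3*q+2) (q+j+1) (3*q+2-j) (2*q+1-j) hj.2 (by omega)
          (by omega) (by omega) (by omega) 1 3 2 (-27) (by norm_num) hz hm (by omega) (by omega)
          (by omega) (by norm_num)
      · by_cases c2 : j < 3*q+2
        · have : cc q j = -9 := by unfold cc; rw [if_neg c1, if_pos c2]
          rw [this]
          exact offm (p := p) r n hn h4 j (3*q+2) (q+j+1) (3*q+2-j) (6*q+4-j) hj.2 (by omega)
            (by omega) (by omega) (by omega) 1 3 6 (-9) (by norm_num) hz hm (by omega) (by omega)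
            (by omega) (by norm_num)
        · have : cc q j = 63 := by unfold cc; rw [if_neg c1, if_neg c2]
          rw [this]
          exact offm (p := p) r n hn h4 j (3*q+2) (j-(3*q+2)) (7*q+5-j) (6*q+4-j) hj.2 (by omega)
            (by omega) (by omega) (by omega) (-3) 7 6 63 (by norm_num) hz hm (by omega) (by omega)
            (by omega) (by norm_num)
    have := (A.add B).add C
    convert this using 1
    rw [← add_sum_erase (range n) _ (mem_range.2 (show 3*q+2 < n by omega)), sum_sub_distrib]
    have e : ∑ j ∈ (range n).erase (3*q+2), (cc q j : ℚ) * ((n:ℚ) * ((n:ℚ) / (4 * j + 1))^2) =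
        (n:ℚ) * ∑ j ∈ (range n).erase (3*q+2), (cc q j : ℚ) * ((n:ℚ) / (4 * j + 1))^2 := by
      rw [mul_sum]; apply sum_congr rfl; intros; ring
    rw [e]; push_cast; ring
  unfold ratCongr
  by_cases h0 : ∑ j ∈ range n, (1 + 4 * (j:ℚ)) * WW n j = (3 * (n:ℚ) + 27/4 * (n:ℚ)^3 * H2 q)
  · left; exact h0
  · right
    unfold DD at key
    rw [padicNorm.eq_zpow_of_nonzero (sub_ne_zero.2 h0), zpow_le_zpow_iff_right₀ p_one_lt] at key
    have := neg_le_neg_iff.1 key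
    exact this
end
end

section
/- Let c, d, s be positive integers with d ≥ 2, 1 ≤ c, s ≤ d and gcd(cs, d) = 1, and let p be a prime with p ≡ s (mod d). Then the least positive integer n with (c/d)^{*_n} = c/d equals the multiplicative order of s modulo d (the least positive integer n such that s^n ≡ 1 (mod d)). -/
noncomputable section

lemma dash_step (p d a : ℕ) (hp : p.Prime) (hpd : Nat.Coprime p d) (ha1 : 1 ≤ a) (had : a < d)
    (hco : Nat.Coprime a d) :
    ∃ b : ℕ, 1 ≤ b ∧ b < d ∧ Nat.Coprime b d ∧ dash p ((a : ℚ) / d) = (b : ℚ) / d ∧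
      ((p : ZMod d) * b = a) := by
  have : Fact p.Prime := ⟨hp⟩
  have hd0 : 0 < d := by omega
  have hnum : ((a : ℚ) / d).num = a := by
    have := Rat.num_div_eq_of_coprime (a := (a : ℤ)) (b := (d : ℤ)) (by exact_mod_cast hd0)
      (by simpa using hco)
    simpa using this
  have hden : ((a : ℚ) / d).den = d := by
    have := Rat.den_div_eq_of_coprime (a := (a : ℤ)) (b := (d : ℤ)) (by exact_mod_cast hd0)
      (by simpa using hco)
    have h2 : ((((a : ℚ) / d).den : ℕ) : ℤ) = d := by simpa using this
    exact_mod_cast h2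
  have hdp : (d : ZMod p) ≠ 0 := by
    intro h
    rw [ZMod.natCast_eq_zero_iff] at h
    exact hp.one_lt.ne' (Nat.eq_one_of_dvd_coprimes hpd dvd_rfl h)
  obtain ⟨r, hr⟩ : ∃ r, r = res p (-((a : ℚ) / d)) := ⟨_, rfl⟩
  have hrp : r < p := by rw [hr]; exact ZMod.val_lt _
  have hrc : (r : ZMod p) = -(a : ZMod p) * (d : ZMod p)⁻¹ := by
    rw [hr, res, ZMod.natCast_zmod_val, Rat.num_neg_eq_neg_num, Rat.den_neg_eq_den, hnum, hden]
    simp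
  have hdvd : p ∣ a + r * d := by
    rw [← ZMod.natCast_eq_zero_iff]
    push_cast
    rw [hrc]
    field_simp
    ring
  obtain ⟨b, hb⟩ := hdvd
  have hz : ((p : ZMod d) * b = a) := by
    have := congrArg (Nat.cast : ℕ → ZMod d) hb
    push_cast at this
    simpa using this.symm
  refine ⟨b, ?_, ?_, ?_, ?_, hz⟩
  · rcases Nat.eq_zero_or_pos b with h | h
    · subst h; omega
    · exact h
  · have h1 : (r + 1) * d ≤ p * d := Nat.mul_le_mul_right _ hrp
    have h2 : p * b < p * d := by rw [← hb]; linarith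
    exact lt_of_mul_lt_mul_left h2 (Nat.zero_le _)
  · have h : Nat.Coprime (a + r * d) d := by simpa using hco
    rw [hb] at h
    exact Nat.Coprime.coprime_mul_left h
  · rw [dash, ← hr]
    have hq : (a : ℚ) + r * d = p * b := by exact_mod_cast hb
    have : (p : ℚ) ≠ 0 := by exact_mod_cast hp.ne_zero
    have : (d : ℚ) ≠ 0 := by exact_mod_cast hd0.ne'
    field_simp
    linarith

lemma dash_iter (p d a : ℕ) (hp : p.Prime) (hpd : Nat.Coprime p d) (ha1 : 1 ≤ a) (had : a < d)
    (hco : Nat.Coprime a d) (n : ℕ) :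
    ∃ b : ℕ, 1 ≤ b ∧ b < d ∧ Nat.Coprime b d ∧ dashIter p n ((a : ℚ) / d) = (b : ℚ) / d ∧
      ((p : ZMod d) ^ n * b = a) := by
  induction n with
  | zero => exact ⟨a, ha1, had, hco, rfl, by simp⟩
  | succ n ih =>
    obtain ⟨b, h1, h2, h3, h4, h5⟩ := ih
    obtain ⟨e, e1, e2, e3, e4, e5⟩ := dash_step p d b hp hpd h1 h2 h3
    refine ⟨e, e1, e2, e3, ?_, ?_⟩
    · rw [dashIter, Function.iterate_succ_apply']
      rw [dashIter] at h4
      rw [h4, e4]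
    · rw [pow_succ, mul_assoc, e5, h5]

theorem stmt5 (c d s : ℕ) (hc1 : 1 ≤ c) (hcd : c ≤ d) (hs1 : 1 ≤ s) (hsd : s ≤ d)
    (hd : 2 ≤ d) (hgcd : Nat.gcd (c * s) d = 1)
    (p : ℕ) (hp : p.Prime) (hps : p ≡ s [MOD d]) :
    IsLeast {n : ℕ | 0 < n ∧ dashIter p n ((c : ℚ) / d) = (c : ℚ) / d}
      (orderOf (s : ZMod d)) := by
  have hc : Nat.Coprime c d := Nat.Coprime.coprime_mul_right hgcd
  have hs : Nat.Coprime s d := Nat.Coprime.coprime_mul_left hgcd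
  have hp' : Nat.Coprime p d := by
    rw [Nat.Coprime, hps.gcd_eq]; exact hs
  have hlt : c < d := by
    rcases hcd.lt_or_eq with h | h
    · exact h
    · subst h; simp at hc; omega
  have hpsz : (p : ZMod d) = s := (ZMod.natCast_eq_natCast_iff _ _ _).2 hps
  have : NeZero d := ⟨by omega⟩
  have hd0 : (d : ℚ) ≠ 0 := by exact_mod_cast (by omega : d ≠ 0)
  have hcu : IsUnit (c : ZMod d) := (ZMod.isUnit_iff_coprime c d).2 hc
  have hsu : IsUnit (s : ZMod d) := (ZMod.isUnit_iff_coprime s d).2 hs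
  have key : ∀ n, dashIter p n ((c : ℚ) / d) = (c : ℚ) / d ↔ (s : ZMod d) ^ n = 1 := by
    intro n
    obtain ⟨b, h1, h2, h3, h4, h5⟩ := dash_iter p d c hp hp' hc1 hlt hc n
    rw [h4, div_left_inj' hd0, Nat.cast_inj]
    rw [hpsz] at h5
    constructor
    · rintro rfl
      exact hcu.mul_right_cancel (by rw [h5, one_mul])
    · intro h
      rw [h, one_mul, ZMod.natCast_eq_natCast_iff] at h5
      exact Nat.ModEq.eq_of_lt_of_lt h5 h2 hlt
  constructor
  · refine ⟨?_, (key _).2 (pow_orderOf_eq_one _)⟩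
    obtain ⟨u, hu⟩ := hsu
    rw [← hu, orderOf_units]
    exact orderOf_pos u
  · rintro n ⟨hn, h⟩
    exact orderOf_le_of_pow_eq_one hn ((key n).1 h)
end
end
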